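/- For integers r, s of even difference with |r−s|/2 ≤ k, ∫₀^∞ a^{2k+1} e^{−πa²} J_{s−r}(2πaρ) da = (−1)^{s−r} C_{r,s;k}(ρ) · ₁F₁(|r−s|/2 − k; |r−s|+1; πρ²) e^{−πρ²}, where C_{r,s;k}(ρ) = Γ(k + 1 + |r−s|/2)(ρ√π)^{|r−s|} / (2 π^{k+1} Γ(|r−s|+1)). -/

import Mathlib

open Real Complex MeasureTheory

/-- Bessel function of the first kind of integer order (Bessel's integral). -/
noncomputable def besselJ (n : ℤ) (z : ℝ) : ℂ :=
  (1 / (2 * Real.pi)) *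
    ∫ ξ in (0:ℝ)..(2 * Real.pi), Complex.exp (Complex.I * (n * ξ - z * Real.sin ξ))

/-- Pochhammer symbol `(a)_j = a(a+1)⋯(a+j−1)`. -/
noncomputable def poch (a : ℝ) (j : ℕ) : ℝ := ∏ i ∈ Finset.range j, (a + i)

/-- The terminating confluent hypergeometric series
`₁F₁(−n; b; x) = Σ_{j=0}^n (−n)_j x^j / ((b)_j j!)`. -/
noncomputable def hyp1F1Neg (n : ℕ) (b x : ℝ) : ℝ :=
  ∑ j ∈ Finset.range (n + 1), poch (-(n : ℝ)) j * x ^ j / (poch b j * j.factorial)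

/-- Orthogonality of the characters of the circle. -/
theorem integral_exp_int_mul_I (n : ℤ) :
    ∫ ξ in (0:ℝ)..(2 * Real.pi), Complex.exp (Complex.I * (n * ξ)) =
      if n = 0 then (2 * Real.pi : ℂ) else 0 := by
  split_ifs with h
  · simp [h]
  · have hc : Complex.I * (n : ℂ) ≠ 0 := mul_ne_zero Complex.I_ne_zero (by exact_mod_cast h)
    simp only [← mul_assoc]
    rw [integral_exp_mul_complex hc]
    have h1 : Complex.exp (Complex.I * n * ((2 * Real.pi : ℝ) : ℂ)) = 1 := by
      rw [Complex.exp_eq_one_iff]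
      exact ⟨n, by push_cast; ring⟩
    rw [h1]
    simp

theorem integral_exp_mul_sin_pow (n : ℤ) (p : ℕ) :
    ∫ ξ in (0:ℝ)..(2 * Real.pi),
        Complex.exp (Complex.I * (n * ξ)) * (Real.sin ξ : ℂ) ^ p =
      ∑ l ∈ Finset.range (p + 1), (Complex.I / 2) ^ p * (-1) ^ (p - l) * (p.choose l : ℂ) *
        if n + p - 2 * l = 0 then (2 * Real.pi : ℂ) else 0 := by
  have key : ∀ ξ : ℝ, Complex.exp (Complex.I * (n * ξ)) * (Real.sin ξ : ℂ) ^ p =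
      ∑ l ∈ Finset.range (p + 1), (Complex.I / 2) ^ p * (-1) ^ (p - l) * (p.choose l : ℂ) *
        Complex.exp (Complex.I * ((n + p - 2 * l : ℤ) * ξ)) := by
    intro ξ
    have hs : (Real.sin ξ : ℂ) = (Complex.I / 2) *
        (Complex.exp (-ξ * Complex.I) + -1 * Complex.exp (ξ * Complex.I)) := by
      rw [Complex.ofReal_sin, Complex.sin]; ring
    rw [hs, mul_pow, add_pow, Finset.mul_sum, Finset.mul_sum]
    refine Finset.sum_congr rfl fun l hl => ?_
    have hl' : l ≤ p := Nat.lt_succ_iff.mp (Finset.mem_range.mp hl)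
    rw [mul_pow, ← Complex.exp_nat_mul, ← Complex.exp_nat_mul]
    have he : Complex.exp (Complex.I * ((n + p - 2 * l : ℤ) * ξ)) =
        Complex.exp (Complex.I * (n * ξ)) * Complex.exp (l * (-ξ * Complex.I)) *
          Complex.exp ((p - l : ℕ) * (ξ * Complex.I)) := by
      rw [← Complex.exp_add, ← Complex.exp_add]
      congr 1
      push_cast [Nat.cast_sub hl']
      ring
    rw [he]
    ring
  simp_rw [key]
  rw [intervalIntegral.integral_finsetSum]
  · refine Finset.sum_congr rfl fun l _ => ?_
    rw [intervalIntegral.integral_const_mul, integral_exp_int_mul_I]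
  · intro l _
    exact Continuous.intervalIntegrable (by fun_prop) _ _

theorem integral_exp_mul_sin_pow_odd (m q : ℕ) :
    ∫ ξ in (0:ℝ)..(2 * Real.pi),
        Complex.exp (Complex.I * (((2 * m : ℕ) : ℤ) * ξ)) * (Real.sin ξ : ℂ) ^ (2 * q + 1) = 0 := by
  rw [integral_exp_mul_sin_pow]
  refine Finset.sum_eq_zero fun l _ => ?_
  rw [if_neg (by omega), mul_zero]

theorem integral_exp_mul_sin_pow_even (m q : ℕ) :
    ∫ ξ in (0:ℝ)..(2 * Real.pi),
        Complex.exp (Complex.I * (((2 * m : ℕ) : ℤ) * ξ)) * (Real.sin ξ : ℂ) ^ (2 * q) =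
      2 * Real.pi * ((-1) ^ m * ((2 * q).choose (q + m) : ℂ) / 4 ^ q) := by
  rw [integral_exp_mul_sin_pow]
  rcases lt_or_ge q m with h | h
  · rw [Nat.choose_eq_zero_of_lt (by omega)]
    refine (Finset.sum_eq_zero fun l hl => ?_).trans (by simp)
    have := Finset.mem_range.mp hl
    rw [if_neg (by omega), mul_zero]
  · rw [Finset.sum_eq_single (q + m)]
    · rw [if_pos (by push_cast; ring)]
      obtain ⟨d, rfl⟩ := Nat.exists_eq_add_of_le h
      have h1 : 2 * (m + d) - (m + d + m) = d := by omega
      have h2 : (Complex.I / 2) ^ (2 * (m + d)) = (-1) ^ m * (-1) ^ d / 4 ^ (m + d) := by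
        rw [pow_mul, div_pow, Complex.I_sq, div_pow, ← pow_add]
        norm_num
      have h3 : ((-1 : ℂ)) ^ d * (-1) ^ d = 1 := by rw [← mul_pow]; simp
      rw [h1, h2]
      linear_combination ((-1) ^ m / 4 ^ (m + d) * ((2 * (m + d)).choose (m + d + m) : ℂ) *
        (2 * Real.pi)) * h3
    · intro l _ hl
      rw [if_neg (by omega), mul_zero]
    · intro hl
      rw [Finset.mem_range] at hl
      omega

theorem hasSum_besselJ_sin_moments (n : ℤ) (z : ℝ) :
    HasSum (fun p : ℕ => (1 / (2 * Real.pi)) * ((-(Complex.I * z)) ^ p / p.factorial *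
      ∫ ξ in (0:ℝ)..(2 * Real.pi),
        Complex.exp (Complex.I * (n * ξ)) * (Real.sin ξ : ℂ) ^ p)) (besselJ n z) := by
  unfold besselJ
  refine HasSum.mul_left _ ?_
  simp_rw [← intervalIntegral.integral_const_mul]
  refine intervalIntegral.hasSum_integral_of_dominated_convergence
    (fun p _ => |z| ^ p / p.factorial) ?_ ?_ ?_ ?_ ?_
  · intro p
    exact Continuous.aestronglyMeasurable (by fun_prop)
  · intro p
    refine Filter.Eventually.of_forall fun ξ _ => ?_
    have h1 : ‖Complex.exp (Complex.I * (n * ξ))‖ = 1 := by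
      have := Complex.norm_exp_I_mul_ofReal (n * ξ)
      push_cast at this
      exact this
    have h2 : |Real.sin ξ| ^ p ≤ 1 := pow_le_one₀ (abs_nonneg _) (Real.abs_sin_le_one ξ)
    rw [norm_mul, norm_mul, h1, norm_div, norm_pow, norm_pow, norm_neg, norm_mul,
      Complex.norm_I, Complex.norm_real, Complex.norm_real, Complex.norm_natCast,
      Real.norm_eq_abs, Real.norm_eq_abs, one_mul, one_mul]
    exact mul_le_of_le_one_right (by positivity) h2
  · exact Filter.Eventually.of_forall fun ξ _ => Real.summable_pow_div_factorial |z|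
  · exact intervalIntegrable_const
  · refine Filter.Eventually.of_forall fun ξ _ => ?_
    have h := (NormedSpace.expSeries_div_hasSum_exp (-(Complex.I * z) * (Real.sin ξ : ℂ))).mul_left
      (Complex.exp (Complex.I * (n * ξ)))
    rw [← Complex.exp_eq_exp_ℂ, ← Complex.exp_add] at h
    rw [show Complex.I * (n * ξ - z * (Real.sin ξ : ℂ)) =
      Complex.I * (n * ξ) + -(Complex.I * z) * (Real.sin ξ : ℂ) by ring]
    refine h.congr_fun fun p => ?_
    rw [mul_pow]; ring

/-- The power series of `J_{2m}`. -/
theorem hasSum_besselJ_two_mul (m : ℕ) (z : ℝ) :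
    HasSum (fun j : ℕ => (((-1) ^ j * (z / 2) ^ (2 * (m + j)) /
      (j.factorial * (2 * m + j).factorial) : ℝ) : ℂ)) (besselJ ((2 * m : ℕ) : ℤ) z) := by
  have hinj : Function.Injective (fun j : ℕ => 2 * (m + j)) := fun a b h => by
    simpa using h
  have h := (hinj.hasSum_iff ?_).mpr (hasSum_besselJ_sin_moments ((2 * m : ℕ) : ℤ) z)
  · convert h using 1
    funext j
    simp only [Function.comp_apply]
    rw [integral_exp_mul_sin_pow_even]
    have hpi : (Real.pi : ℂ) ≠ 0 := by exact_mod_cast Real.pi_ne_zero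
    have hch : ((2 * (m + j)).choose (m + j + m) : ℂ) =
        (2 * (m + j)).factorial / ((2 * m + j).factorial * j.factorial) := by
      rw [Nat.cast_choose ℂ (by omega), show m + j + m = 2 * m + j by ring,
        show 2 * (m + j) - (2 * m + j) = j by omega]
    have h1 : (-(Complex.I * z)) ^ (2 * (m + j)) = (-1) ^ m * (-1) ^ j * (z : ℂ) ^ (2 * (m + j)) := by
      rw [neg_pow, mul_pow, pow_mul Complex.I, Complex.I_sq, pow_mul (-1 : ℂ) 2, pow_add (-1 : ℂ) m]
      simp
    have h2 : ((z : ℂ) / 2) ^ (2 * (m + j)) = (z : ℂ) ^ (2 * (m + j)) / 4 ^ (m + j) := by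
      rw [div_pow, pow_mul (2 : ℂ)]; norm_num
    have h3 : ((-1 : ℂ)) ^ m * (-1) ^ m = 1 := by rw [← mul_pow]; simp
    have hf : ((2 * (m + j)).factorial : ℂ) ≠ 0 := by exact_mod_cast Nat.factorial_ne_zero _
    have hf1 : ((2 * m + j).factorial : ℂ) ≠ 0 := by exact_mod_cast Nat.factorial_ne_zero _
    have hf2 : (j.factorial : ℂ) ≠ 0 := by exact_mod_cast Nat.factorial_ne_zero _
    push_cast
    rw [hch, h1, h2]
    field_simp
    linear_combination (-(z : ℂ) ^ (2 * (m + j))) * h3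
  · intro p hp
    rcases Nat.even_or_odd' p with ⟨q, rfl | rfl⟩
    · have hq : q < m := by
        by_contra hq
        exact hp ⟨q - m, by simp only; omega⟩
      rw [integral_exp_mul_sin_pow_even, Nat.choose_eq_zero_of_lt (by omega)]
      simp
    · rw [integral_exp_mul_sin_pow_odd]
      simp

theorem besselJ_neg_two_mul (m : ℕ) (z : ℝ) :
    besselJ (-((2 * m : ℕ) : ℤ)) z = besselJ ((2 * m : ℕ) : ℤ) z := by
  have key : ∀ p : ℕ, (∫ ξ in (0:ℝ)..(2 * Real.pi),
      Complex.exp (Complex.I * ((-((2 * m : ℕ) : ℤ) : ℤ) * ξ)) * (Real.sin ξ : ℂ) ^ p) =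
      ∫ ξ in (0:ℝ)..(2 * Real.pi),
        Complex.exp (Complex.I * (((2 * m : ℕ) : ℤ) * ξ)) * (Real.sin ξ : ℂ) ^ p := by
    intro p
    rw [integral_exp_mul_sin_pow, integral_exp_mul_sin_pow, ← Finset.sum_range_reflect]
    refine Finset.sum_congr rfl fun l hl => ?_
    have hl' : l ≤ p := Nat.lt_succ_iff.mp (Finset.mem_range.mp hl)
    have e1 : p + 1 - 1 - l = p - l := by omega
    rw [e1, Nat.choose_symm hl', Nat.sub_sub_self hl']
    by_cases h : ((2 * m : ℕ) : ℤ) + p - 2 * l = 0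
    · rw [if_pos h, if_pos (by omega)]
      have : (-1 : ℂ) ^ l = (-1) ^ (p - l) := by
        have h2 : l = (p - l) + 2 * m := by omega
        conv_lhs => rw [h2, pow_add, pow_mul]
        simp
      rw [this]
    · rw [if_neg h, if_neg (by omega)]
      simp
  have h := hasSum_besselJ_sin_moments (-((2 * m : ℕ) : ℤ)) z
  simp_rw [key] at h
  exact h.unique (hasSum_besselJ_sin_moments _ z)

/-- The odd moments of a centred Gaussian on the half line. -/
theorem integral_pow_odd_mul_exp_neg_pi_sq (M : ℕ) :
    ∫ a in Set.Ioi (0:ℝ), a ^ (2 * M + 1) * Real.exp (-(Real.pi * a ^ 2)) =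
      M.factorial / (2 * Real.pi ^ (M + 1)) := by
  have h := _root_.integral_rpow_mul_exp_neg_mul_rpow (p := 2) (q := ((2 * M + 1 : ℕ) : ℝ))
    (b := Real.pi) two_pos (by push_cast; linarith [(Nat.cast_nonneg M : (0:ℝ) ≤ M)])
    Real.pi_pos
  have e1 : ((2 * M + 1 : ℕ) + 1 : ℝ) / 2 = M + 1 := by push_cast; ring
  rw [neg_div, e1, Real.Gamma_nat_eq_factorial, Real.rpow_neg Real.pi_pos.le] at h
  have e2 : Real.pi ^ ((M : ℝ) + 1) = Real.pi ^ (M + 1) := by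
    rw [← Real.rpow_natCast]; push_cast; rfl
  simp_rw [Real.rpow_natCast, Real.rpow_two, neg_mul] at h
  rw [h, e2]
  field_simp

theorem integrableOn_pow_mul_exp_neg_pi_sq (M : ℕ) :
    IntegrableOn (fun a : ℝ => a ^ M * Real.exp (-(Real.pi * a ^ 2))) (Set.Ioi 0) := by
  have h := integrableOn_rpow_mul_exp_neg_mul_sq (b := Real.pi) Real.pi_pos (s := (M : ℝ))
    (by linarith [(Nat.cast_nonneg M : (0:ℝ) ≤ M)])
  simpa only [Real.rpow_natCast, neg_mul] using h

theorem hasSum_choose_mul_pow_div_factorial (i : ℕ) (y : ℝ) :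
    HasSum (fun j : ℕ => (j.choose i : ℝ) * y ^ j / j.factorial)
      (y ^ i / i.factorial * Real.exp y) := by
  have h := (NormedSpace.expSeries_div_hasSum_exp y).mul_left (y ^ i / i.factorial)
  rw [← Real.exp_eq_exp_ℝ] at h
  refine ((add_right_injective i).hasSum_iff ?_).mp ?_
  · intro j hj
    have : j < i := by
      by_contra hji
      exact hj ⟨j - i, by simp only; omega⟩
    simp [Nat.choose_eq_zero_of_lt this]
  · refine h.congr_fun fun j => ?_
    simp only [Function.comp_apply]
    rw [Nat.cast_choose ℝ (Nat.le_add_right i j), Nat.add_sub_cancel_left, pow_add]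
    have := Nat.factorial_pos (i + j)
    field_simp

/-- A form of Kummer's transformation in the terminating case. -/
theorem hasSum_factorial_div_mul_pow (N b : ℕ) (y : ℝ) :
    HasSum (fun j : ℕ => ((N + b + j).factorial : ℝ) / (j.factorial * (b + j).factorial) * y ^ j)
      (N.factorial * (∑ i ∈ Finset.range (N + 1),
        ((N + b).choose (N - i) : ℝ) * (y ^ i / i.factorial)) * Real.exp y) := by
  have h := (hasSum_sum (s := Finset.range (N + 1)) fun i _ =>
    (hasSum_choose_mul_pow_div_factorial i y).mul_left ((N + b).choose (N - i) : ℝ)).mul_left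
      (N.factorial : ℝ)
  rw [show (N.factorial : ℝ) * (∑ i ∈ Finset.range (N + 1),
      ((N + b).choose (N - i) : ℝ) * (y ^ i / i.factorial)) * Real.exp y = N.factorial *
        ∑ i ∈ Finset.range (N + 1), ((N + b).choose (N - i) : ℝ) *
          (y ^ i / i.factorial * Real.exp y) from ?_]
  · refine h.congr_fun fun j => ?_
    have hv : ((N + b + j).factorial : ℝ) = N.factorial * (b + j).factorial *
        ∑ i ∈ Finset.range (N + 1), (j.choose i : ℝ) * ((N + b).choose (N - i) : ℝ) := by
      have h1 := Nat.add_choose_eq j (N + b) N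
      rw [Finset.Nat.sum_antidiagonal_eq_sum_range_succ_mk] at h1
      have h2 := Nat.choose_mul_factorial_mul_factorial (n := j + (N + b)) (k := N) (by omega)
      rw [show j + (N + b) - N = b + j by omega, h1] at h2
      rw [show N + b + j = j + (N + b) by ring, ← h2]
      push_cast
      ring
    rw [hv]
    have h3 : ∑ i ∈ Finset.range (N + 1), ((N + b).choose (N - i) : ℝ) *
        ((j.choose i : ℝ) * y ^ j / j.factorial) =
        (∑ i ∈ Finset.range (N + 1), (j.choose i : ℝ) * ((N + b).choose (N - i) : ℝ)) *
          (y ^ j / j.factorial) := by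
      rw [Finset.sum_mul]
      exact Finset.sum_congr rfl fun i _ => by ring
    rw [h3]
    field_simp
  · rw [mul_assoc, Finset.sum_mul]
    congr 1
    exact Finset.sum_congr rfl fun i _ => by ring

theorem poch_neg_natCast (N i : ℕ) (hi : i ≤ N) :
    poch (-(N : ℝ)) i = (-1) ^ i * (N.factorial / (N - i).factorial) := by
  induction i with
  | zero => simp [poch, Nat.factorial_ne_zero]
  | succ i ih =>
    have hs : N - i = (N - (i + 1)) + 1 := by omega
    have hc : ((N - (i + 1) : ℕ) : ℝ) + 1 = N - i := by
      rw [Nat.cast_sub hi]; push_cast; ring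
    have hne : (N : ℝ) - i ≠ 0 := by rw [← hc]; positivity
    rw [poch, Finset.prod_range_succ, ← poch, ih (by omega), hs, Nat.factorial_succ]
    push_cast
    rw [hc]
    field_simp
    ring

theorem poch_natCast_add_one (b i : ℕ) :
    poch ((b : ℝ) + 1) i = (b + i).factorial / b.factorial := by
  induction i with
  | zero => simp [poch, Nat.factorial_ne_zero]
  | succ i ih =>
    rw [poch, Finset.prod_range_succ, ← poch, ih, ← add_assoc b i 1, Nat.factorial_succ]
    push_cast
    ring

theorem factorial_mul_hyp1F1Neg (N b : ℕ) (x : ℝ) :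
    ((N + b).factorial : ℝ) / b.factorial * hyp1F1Neg N (b + 1) x =
      N.factorial * ∑ i ∈ Finset.range (N + 1),
        ((N + b).choose (N - i) : ℝ) * ((-x) ^ i / i.factorial) := by
  rw [hyp1F1Neg, Finset.mul_sum, Finset.mul_sum]
  refine Finset.sum_congr rfl fun i hi => ?_
  have hi' : i ≤ N := Nat.lt_succ_iff.mp (Finset.mem_range.mp hi)
  rw [poch_neg_natCast N i hi', poch_natCast_add_one, Nat.cast_choose ℝ (by omega),
    show N + b - (N - i) = b + i by omega, neg_pow x i]
  field_simp

theorem integral_pow_mul_exp_mul_besselJ (k m : ℕ) (hkm : m ≤ k) (ρ : ℝ) :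
    ∫ a in Set.Ioi (0:ℝ),
        (a : ℂ) ^ (2 * k + 1) * Complex.exp (-(Real.pi * a ^ 2)) *
          besselJ ((2 * m : ℕ) : ℤ) (2 * Real.pi * a * ρ) =
      (((Real.pi * ρ ^ 2) ^ m / (2 * Real.pi ^ (k + 1)) *
        (((k + m).factorial : ℝ) / (2 * m).factorial *
          hyp1F1Neg (k - m) ((2 * m : ℕ) + 1) (Real.pi * ρ ^ 2) *
            Real.exp (-(Real.pi * ρ ^ 2))) : ℝ) : ℂ) := by
  obtain ⟨N, rfl⟩ := Nat.exists_eq_add_of_le hkm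
  set x := Real.pi * ρ ^ 2 with hx
  let c : ℕ → ℝ := fun j => (Real.pi * ρ) ^ (2 * (m + j)) / (j.factorial * (2 * m + j).factorial)
  let G : ℕ → ℝ → ℝ := fun j a => a ^ (2 * (m + N + m + j) + 1) * Real.exp (-(Real.pi * a ^ 2))
  have hc0 : ∀ j, 0 ≤ c j := fun j => by
    have : 0 ≤ (Real.pi * ρ) ^ (2 * (m + j)) := by rw [pow_mul]; positivity
    positivity
  have hG : ∀ j, ∫ a in Set.Ioi (0:ℝ), c j * G j a = x ^ m / (2 * Real.pi ^ (m + N + 1)) *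
      (((N + 2 * m + j).factorial : ℝ) / (j.factorial * (2 * m + j).factorial) * x ^ j) := by
    intro j
    rw [integral_const_mul, integral_pow_odd_mul_exp_neg_pi_sq, show m + N + m + j = N + 2 * m + j by ring,
      hx]
    have : (Real.pi * ρ) ^ (2 * (m + j)) = (Real.pi * ρ ^ 2) ^ m * (Real.pi * ρ ^ 2) ^ j *
        Real.pi ^ (m + j) := by ring
    simp only [c]
    rw [this, show N + 2 * m + j + 1 = (m + N + 1) + (m + j) by ring, pow_add Real.pi (m + N + 1)]
    field_simp
  have hint : ∀ j, IntegrableOn (fun a => (((-1) ^ j * (c j * G j a) : ℝ) : ℂ)) (Set.Ioi 0) :=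
    fun j => (((integrableOn_pow_mul_exp_neg_pi_sq _).const_mul (c j)).const_mul ((-1) ^ j)).ofReal
  have hsum := hasSum_integral_of_summable_integral_norm hint ?_
  · have hval : ∀ j, ∫ a in Set.Ioi (0:ℝ), (((-1) ^ j * (c j * G j a) : ℝ) : ℂ) =
        ((x ^ m / (2 * Real.pi ^ (m + N + 1)) * (((N + 2 * m + j).factorial : ℝ) /
          (j.factorial * (2 * m + j).factorial) * (-x) ^ j) : ℝ) : ℂ) := by
      intro j
      rw [integral_complex_ofReal, integral_const_mul, hG, neg_pow x j]
      congr 1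
      ring
    simp_rw [hval] at hsum
    have hK := Complex.hasSum_ofReal.mpr ((hasSum_factorial_div_mul_pow N (2 * m) (-x)).mul_left
      (x ^ m / (2 * Real.pi ^ (m + N + 1))))
    rw [← factorial_mul_hyp1F1Neg] at hK
    rw [show m + N - m = N by omega, show m + N + m = N + 2 * m by ring, ← hsum.unique hK]
    refine integral_congr_ae (Filter.Eventually.of_forall fun a => ?_)
    have hB := (hasSum_besselJ_two_mul m (2 * Real.pi * a * ρ)).mul_left
      ((a : ℂ) ^ (2 * (m + N) + 1) * Complex.exp (-(Real.pi * a ^ 2)))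
    simp only
    rw [← hB.tsum_eq]
    refine tsum_congr fun j => ?_
    simp only [c, G]
    push_cast
    ring
  · have hn : ∀ j, ∫ a in Set.Ioi (0:ℝ), ‖(((-1) ^ j * (c j * G j a) : ℝ) : ℂ)‖ =
        x ^ m / (2 * Real.pi ^ (m + N + 1)) *
          (((N + 2 * m + j).factorial : ℝ) / (j.factorial * (2 * m + j).factorial) * x ^ j) := by
      intro j
      rw [← hG]
      refine setIntegral_congr_fun measurableSet_Ioi fun a ha => ?_
      have ha' : (0:ℝ) < a := ha
      have hG0 : 0 ≤ G j a := by positivity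
      simp only [Complex.norm_real, Real.norm_eq_abs, abs_mul, abs_pow, abs_neg, abs_one, one_pow,
        one_mul, abs_of_nonneg (hc0 j), abs_of_nonneg hG0]
    simp_rw [hn]
    exact (hasSum_factorial_div_mul_pow N (2 * m) x).summable.mul_left _

/-- For integers `r, s` with `|r − s| = 2m` even and `m ≤ k`,
`∫₀^∞ a^{2k+1} e^{−πa²} J_{s−r}(2πaρ) da
  = (−1)^{s−r} C_{r,s;k}(ρ) ₁F₁(m − k; 2m+1; πρ²) e^{−πρ²}`,
where `C_{r,s;k}(ρ) = Γ(k+1+m)(ρ√π)^{2m} / (2π^{k+1} Γ(2m+1))`. -/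
theorem stmt14 (r s : ℤ) (k m : ℕ) (hm : (r - s).natAbs = 2 * m) (hkm : m ≤ k)
    (ρ : ℝ) (hρ : 0 ≤ ρ) :
    ∫ a in Set.Ioi (0:ℝ),
        (a : ℂ) ^ (2 * k + 1) * Complex.exp (-(Real.pi * a ^ 2)) *
          besselJ (s - r) (2 * Real.pi * a * ρ)
      = (-1 : ℂ) ^ (s - r) *
        ((Real.Gamma (k + 1 + m) * (ρ * Real.sqrt Real.pi) ^ (2 * m) /
            (2 * Real.pi ^ (k + 1) * Real.Gamma (2 * m + 1)) : ℝ) : ℂ) *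
        ((hyp1F1Neg (k - m) (2 * m + 1) (Real.pi * ρ ^ 2) : ℝ) : ℂ) *
        Complex.exp (-(Real.pi * ρ ^ 2)) := by
  have hev : s - r = ((2 * m : ℕ) : ℤ) ∨ s - r = -((2 * m : ℕ) : ℤ) := by omega
  have hsign : (-1 : ℂ) ^ (s - r) = 1 := by
    refine Even.neg_one_zpow ?_
    rw [Int.even_iff]
    omega
  have hJ : ∀ z, besselJ (s - r) z = besselJ ((2 * m : ℕ) : ℤ) z := by
    intro z
    rcases hev with h | h
    · rw [h]
    · rw [h, besselJ_neg_two_mul]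
  simp_rw [hJ]
  rw [integral_pow_mul_exp_mul_besselJ k m hkm ρ, hsign]
  have hG1 : Real.Gamma ((k : ℝ) + 1 + m) = (k + m).factorial := by
    rw [← Real.Gamma_nat_eq_factorial]
    congr 1
    push_cast
    ring
  have hG2 : Real.Gamma (2 * (m : ℝ) + 1) = (2 * m).factorial := by
    rw [← Real.Gamma_nat_eq_factorial]
    push_cast
    rfl
  have hpow : (ρ * Real.sqrt Real.pi) ^ (2 * m) = (Real.pi * ρ ^ 2) ^ m := by
    rw [pow_mul, mul_pow, Real.sq_sqrt Real.pi_pos.le, mul_comm]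
  rw [hG1, hG2, hpow]
  push_cast
  ring
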